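/- (Interval extension of floating-point division, Lemma 2 for ÷ with positive denominator) Let x̲ ≤ x ≤ x̄ and 0 < y̲ ≤ y ≤ ȳ be real numbers. Then min{x̲/y̲, x̲/ȳ} ≤ x/y ≤ max{x̄/y̲, x̄/ȳ}; moreover, if −maxF ≤ x/y ≤ maxF and z is any directed rounding of x/y, then D(min{x̲/y̲, x̲/ȳ}) ≤ z ≤ U(max{x̄/y̲, x̄/ȳ}). -/

import Mathlib

noncomputable section

/-- The maximum exponent `e_max = 2^(eb-1) - 1`, as an integer. -/
def emax (eb : ℕ) : ℤ := 2 ^ (eb - 1) - 1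

/-- The set of finite floating-point numbers
`F = { M · 2^(e - sb + 1) : M, e ∈ ℤ, |M| ≤ 2^sb - 1, 1 - e_max ≤ e ≤ e_max }`. -/
def Fset (eb sb : ℕ) : Set ℝ :=
  {x | ∃ M e : ℤ, |M| ≤ 2 ^ sb - 1 ∧ 1 - emax eb ≤ e ∧ e ≤ emax eb ∧
    x = (M : ℝ) * (2 : ℝ) ^ (e - (sb : ℤ) + 1)}

/-- `ed = 2^(sb-1)`. -/
def edc (sb : ℕ) : ℝ := 2 ^ (sb - 1)

/-- `em = (ed - 1) / (2^(e_max - 1) · ed)`. -/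
def emc (eb sb : ℕ) : ℝ := (edc sb - 1) / ((2 : ℝ) ^ (emax eb - 1) * edc sb)

/-- The largest finite floating-point number `maxF = (2^sb - 1) · 2^(e_max - sb + 1)`. -/
def maxF (eb sb : ℕ) : ℝ := ((2 : ℝ) ^ sb - 1) * (2 : ℝ) ^ (emax eb - (sb : ℤ) + 1)

/-- The downward rounding approximation `D(x) = x - |x|/ed - em`. -/
def Dr (eb sb : ℕ) (x : ℝ) : ℝ := x - |x| / edc sb - emc eb sb

/-- The upward rounding approximation `U(x) = x + |x|/ed + em`. -/
def Ur (eb sb : ℕ) (x : ℝ) : ℝ := x + |x| / edc sb + emc eb sb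

/-- `z` is a directed rounding of `x`: the greatest element of `F` below `x`
or the least element of `F` above `x`. -/
def DirRound (eb sb : ℕ) (x z : ℝ) : Prop :=
  IsGreatest {y ∈ Fset eb sb | y ≤ x} z ∨ IsLeast {y ∈ Fset eb sb | x ≤ y} z

lemma core (eb sb : ℕ) (hsb : 2 ≤ sb) (t : ℝ) (e : ℤ) (h1 : 1 - emax eb ≤ e) (h2 : e ≤ emax eb)
    (ht : |t| < (2:ℝ) ^ (e + 1)) (hm : t ≤ maxF eb sb) :
    ∃ f ∈ Fset eb sb, t ≤ f ∧ f ≤ t + (2:ℝ) ^ (e - (sb:ℤ) + 1) := by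
  set u : ℝ := (2:ℝ) ^ (e - (sb:ℤ) + 1) with hu
  have hu0 : 0 < u := by positivity
  have hpow : (2:ℝ) ^ (e + 1) = 2 ^ sb * u := by
    rw [hu, ← zpow_natCast, ← zpow_add₀ (by norm_num)]; congr 1; ring
  rw [hpow, abs_lt] at ht
  have hc1 : t / u ≤ (⌈t / u⌉ : ℝ) := Int.le_ceil _
  have hc2 : (⌈t / u⌉ : ℝ) < t / u + 1 := Int.ceil_lt_add_one _
  have hf1 : t ≤ (⌈t / u⌉ : ℝ) * u := (div_le_iff₀ hu0).1 hc1
  have hf2 : (⌈t / u⌉ : ℝ) * u ≤ t + u := by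
    have := mul_le_mul_of_nonneg_right hc2.le hu0.le
    rwa [add_mul, div_mul_cancel₀ _ hu0.ne', one_mul] at this
  have hlow : -(2 ^ sb : ℤ) < ⌈t / u⌉ := by
    rw [Int.lt_ceil, lt_div_iff₀ hu0]; push_cast; linarith [ht.1]
  have hup : ⌈t / u⌉ ≤ (2 ^ sb : ℤ) := by
    rw [Int.ceil_le, div_le_iff₀ hu0]; push_cast; linarith [ht.2]
  have hp : (2:ℤ) ^ sb = 2 * 2 ^ (sb - 1) := by
    rw [← pow_succ']; congr 1; omega
  have hp0 : (1:ℤ) ≤ 2 ^ (sb - 1) := one_le_pow₀ (by norm_num)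
  refine ⟨_, ?_, hf1, hf2⟩
  rcases hup.lt_or_eq with hlt | heq
  · exact ⟨⌈t / u⌉, e, by rw [abs_le]; constructor <;> omega, h1, h2, rfl⟩
  · rcases h2.lt_or_eq with h | h
    · refine ⟨2 ^ (sb - 1), e + 1, ?_, by omega, by omega, ?_⟩
      · rw [abs_of_nonneg (by omega)]; omega
      · rw [heq, hp, hu, show e + 1 - (sb:ℤ) + 1 = (e - sb + 1) + 1 by ring,
          zpow_add_one₀ (by norm_num) (e - (sb:ℤ) + 1)]
        push_cast; ring
    · exfalso
      have : ⌈t / u⌉ ≤ (2 ^ sb - 1 : ℤ) := by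
        rw [Int.ceil_le, div_le_iff₀ hu0]; push_cast; rw [hu, h]; exact hm
      omega

lemma edc_ge (sb : ℕ) (hsb : 2 ≤ sb) : 2 ≤ edc sb := by
  unfold edc
  calc (2:ℝ) = 2 ^ 1 := by norm_num
    _ ≤ 2 ^ (sb - 1) := pow_le_pow_right₀ (by norm_num) (by omega)

lemma ulp_eq (sb : ℕ) (hsb : 2 ≤ sb) (e : ℤ) :
    (2:ℝ) ^ (e - (sb:ℤ) + 1) = 2 ^ e / edc sb := by
  unfold edc
  rw [← zpow_natCast, ← zpow_sub₀ (by norm_num)]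
  congr 1
  push_cast [show 1 ≤ sb by omega]; ring

lemma emc_ge (eb sb : ℕ) (hsb : 2 ≤ sb) :
    (2:ℝ) ^ (1 - emax eb) / edc sb ≤ emc eb sb := by
  have h := edc_ge sb hsb
  have : emc eb sb = (edc sb - 1) * ((2:ℝ) ^ (1 - emax eb) / edc sb) := by
    unfold emc
    rw [show 1 - emax eb = -(emax eb - 1) by ring, zpow_neg]
    field_simp
  rw [this]
  have h0 : 0 ≤ (2:ℝ) ^ (1 - emax eb) / edc sb := by positivity
  nlinarith

lemma exists_up (eb sb : ℕ) (heb : 2 ≤ eb) (hsb : 2 ≤ sb) (t : ℝ) (hl : -maxF eb sb ≤ t)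
    (hm : t ≤ maxF eb sb) : ∃ f ∈ Fset eb sb, t ≤ f ∧ f ≤ Ur eb sb t := by
  have hed := edc_ge sb hsb
  have hem := emc_ge eb sb hsb
  have hE : 1 ≤ emax eb := by
    unfold emax
    have : (2:ℤ) ^ 1 ≤ 2 ^ (eb - 1) := pow_le_pow_right₀ (by norm_num) (by omega)
    omega
  have hem0 : 0 ≤ emc eb sb := le_trans (by positivity) hem
  have habs : |t| < (2:ℝ) ^ (emax eb + 1) := by
    have h : |t| ≤ maxF eb sb := abs_le.2 ⟨hl, hm⟩
    refine h.trans_lt ?_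
    have : (2:ℝ) ^ (emax eb + 1) = 2 ^ sb * (2:ℝ) ^ (emax eb - (sb:ℤ) + 1) := by
      rw [← zpow_natCast, ← zpow_add₀ (by norm_num)]; congr 1; ring
    rw [this, maxF]
    have : (0:ℝ) < (2:ℝ) ^ (emax eb - (sb:ℤ) + 1) := by positivity
    nlinarith
  by_cases hs : |t| < (2:ℝ) ^ (1 - emax eb)
  · obtain ⟨f, hf, h1, h2⟩ := core eb sb hsb t (1 - emax eb) le_rfl (by omega)
      (hs.trans (zpow_lt_zpow_right₀ (by norm_num) (by omega))) hm
    refine ⟨f, hf, h1, ?_⟩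
    rw [ulp_eq sb hsb] at h2
    have : 0 ≤ |t| / edc sb := by positivity
    unfold Ur; linarith
  · push Not at hs
    have hp : 0 < |t| := lt_of_lt_of_le (by positivity) hs
    have hlo : (2:ℝ) ^ (Int.log 2 |t|) ≤ |t| := by
      exact_mod_cast Int.zpow_log_le_self (b := 2) (by norm_num) hp
    have hhi : |t| < (2:ℝ) ^ (Int.log 2 |t| + 1) := by
      exact_mod_cast Int.lt_zpow_succ_log_self (b := 2) (by norm_num) |t|
    have e1 := (zpow_lt_zpow_iff_right₀ (by norm_num : (1:ℝ) < 2)).1 (hs.trans_lt hhi)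
    have e2 := (zpow_lt_zpow_iff_right₀ (by norm_num : (1:ℝ) < 2)).1 (hlo.trans_lt habs)
    obtain ⟨f, hf, h1, h2⟩ := core eb sb hsb t (Int.log 2 |t|) (by omega) (by omega) hhi hm
    refine ⟨f, hf, h1, ?_⟩
    rw [ulp_eq sb hsb] at h2
    have : (2:ℝ) ^ (Int.log 2 |t|) / edc sb ≤ |t| / edc sb := by gcongr
    unfold Ur; linarith

lemma Fset_neg (eb sb : ℕ) (f : ℝ) (hf : f ∈ Fset eb sb) : -f ∈ Fset eb sb := by
  obtain ⟨M, e, h1, h2, h3, rfl⟩ := hf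
  exact ⟨-M, e, by rwa [abs_neg], h2, h3, by push_cast; ring⟩

lemma Dr_eq (eb sb : ℕ) (t : ℝ) : Dr eb sb t = -Ur eb sb (-t) := by
  unfold Dr Ur; rw [abs_neg]; ring

lemma Ur_mono (eb sb : ℕ) (hsb : 2 ≤ sb) {s t : ℝ} (h : s ≤ t) : Ur eb sb s ≤ Ur eb sb t := by
  have hed := edc_ge sb hsb
  unfold Ur
  have h1 : |s| - |t| ≤ t - s := by
    have := abs_sub_abs_le_abs_sub s t
    rwa [abs_sub_comm, abs_of_nonneg (sub_nonneg.2 h)] at this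
  have h2 : (|s| - |t|) / edc sb ≤ t - s := by
    rw [div_le_iff₀ (by linarith)]
    nlinarith
  rw [sub_div] at h2
  linarith

lemma le_Ur (eb sb : ℕ) (heb : 2 ≤ eb) (hsb : 2 ≤ sb) (t z : ℝ) (hl : -maxF eb sb ≤ t)
    (hm : t ≤ maxF eb sb) (hz : DirRound eb sb t z) : z ≤ Ur eb sb t := by
  obtain ⟨f, hf, h1, h2⟩ := exists_up eb sb heb hsb t hl hm
  rcases hz with hz | hz
  · exact (hz.1.2.trans h1).trans h2
  · exact (hz.2 ⟨hf, h1⟩).trans h2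

lemma DirRound_neg (eb sb : ℕ) (t z : ℝ) (hz : DirRound eb sb t z) :
    DirRound eb sb (-t) (-z) := by
  rcases hz with ⟨⟨h1, h2⟩, h3⟩ | ⟨⟨h1, h2⟩, h3⟩
  · refine Or.inr ⟨⟨Fset_neg _ _ _ h1, neg_le_neg h2⟩, ?_⟩
    rintro w ⟨hw, hw2⟩
    have := h3 ⟨Fset_neg _ _ _ hw, by linarith⟩
    linarith
  · refine Or.inl ⟨⟨Fset_neg _ _ _ h1, neg_le_neg h2⟩, ?_⟩
    rintro w ⟨hw, hw2⟩
    have := h3 ⟨Fset_neg _ _ _ hw, by linarith⟩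
    linarith

lemma div_le_max_aux (x xu yl y yu : ℝ) (hx2 : x ≤ xu)
    (hypos : 0 < yl) (hy1 : yl ≤ y) (hy2 : y ≤ yu) : x / y ≤ max (xu / yl) (xu / yu) := by
  have hy : 0 < y := by linarith
  have h : x / y ≤ xu / y := by gcongr
  refine h.trans ?_
  rcases le_total 0 xu with h0 | h0
  · exact le_max_of_le_left (by gcongr)
  · refine le_max_of_le_right ?_
    rw [div_le_div_iff₀ hy (by linarith)]
    nlinarith

theorem stmt8 (eb sb : ℕ) (heb : 2 ≤ eb) (hsb : 2 ≤ sb)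
    (xl x xu yl y yu : ℝ)
    (hx1 : xl ≤ x) (hx2 : x ≤ xu)
    (hypos : 0 < yl) (hy1 : yl ≤ y) (hy2 : y ≤ yu) :
    (min (xl / yl) (xl / yu) ≤ x / y ∧ x / y ≤ max (xu / yl) (xu / yu)) ∧
      ∀ z : ℝ, -maxF eb sb ≤ x / y → x / y ≤ maxF eb sb →
        DirRound eb sb (x / y) z →
          Dr eb sb (min (xl / yl) (xl / yu)) ≤ z ∧
            z ≤ Ur eb sb (max (xu / yl) (xu / yu)) := by
  have hmin : min (xl / yl) (xl / yu) ≤ x / y := by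
    have := div_le_max_aux (-x) (-xl) yl y yu (by linarith) hypos hy1 hy2
    rw [neg_div, neg_div, neg_div, max_neg_neg] at this
    linarith
  have hmax := div_le_max_aux x xu yl y yu hx2 hypos hy1 hy2
  refine ⟨⟨hmin, hmax⟩, ?_⟩
  intro z hl hm hz
  refine ⟨?_, (le_Ur eb sb heb hsb _ z hl hm hz).trans (Ur_mono eb sb hsb hmax)⟩
  have h := (le_Ur eb sb heb hsb _ _ (by linarith) (by linarith)
    (DirRound_neg eb sb _ _ hz)).trans (Ur_mono eb sb hsb (neg_le_neg hmin))
  rw [Dr_eq]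
  linarith
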